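/- Let L be a non-abelian Lie algebra of dimension n over an algebraically closed field F of any characteristic. Then L has a maximal subalgebra M that is abelian if and only if L has an abelian ideal A of codimension one in L (equivalently, L = A ∔ F·f where A is an abelian ideal and f acts on A by a nonzero linear map). In particular, in this case α(L) = β(L) = n − 1. -/

import Mathlib

open Module

/-- `α(L)`: the maximal dimension of an abelian Lie subalgebra of `L`. -/
noncomputable def alphaInv (F L : Type*) [Field F] [LieRing L] [LieAlgebra F L] : ℕ :=
  sSup {d | ∃ A : LieSubalgebra F L, IsLieAbelian A ∧ Module.finrank F A = d}

/-- `β(L)`: the maximal dimension of an abelian Lie ideal of `L`. -/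
noncomputable def betaInv (F L : Type*) [Field F] [LieRing L] [LieAlgebra F L] : ℕ :=
  sSup {d | ∃ I : LieIdeal F L, IsLieAbelian I ∧ Module.finrank F I = d}

section AbelianSubalgebra

variable {F L : Type*} [Field F] [LieRing L] [LieAlgebra F L]

/-- An abelian subalgebra `M ≠ ⊤` acts on some nonzero vector of `L ⧸ M` through a character. -/
lemma LieSubalgebra.exists_lie_sub_smul_mem_of_isLieAbelian [IsAlgClosed F]
    [FiniteDimensional F L] (M : LieSubalgebra F L) [IsLieAbelian M] (hM : M ≠ ⊤) :
    ∃ (χ : Dual F M) (v : L), v ∉ M ∧ ∀ m : M, ⁅(m : L), v⁆ - χ m • v ∈ M := by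
  have : Nontrivial (L ⧸ M.toLieSubmodule) := by
    apply Submodule.Quotient.nontrivial_iff.mpr
    intro h
    exact hM (LieSubalgebra.toSubmodule_injective (by simpa using h))
  obtain ⟨χ, hχ⟩ :=
    LieModule.exists_nontrivial_weightSpace_of_isNilpotent F M (L ⧸ M.toLieSubmodule)
  obtain ⟨⟨w, hw⟩, hw0⟩ := exists_ne (0 : LieModule.weightSpace (L ⧸ M.toLieSubmodule) χ)
  obtain ⟨v, rfl⟩ := LieSubmodule.Quotient.surjective_mk' _ w
  rw [LieModule.mem_weightSpace] at hw
  refine ⟨χ, v, fun hv ↦ hw0 ?_, fun m ↦ ?_⟩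
  · exact Subtype.ext (((LieSubmodule.Quotient.mk_eq_zero _).mpr (by simpa using hv)))
  · have h := hw m
    rw [← LieModuleHom.map_lie, ← map_smul, ← sub_eq_zero, ← map_sub,
      LieSubmodule.Quotient.mk_eq_zero] at h
    simpa using h

/-- If `v` is an eigenvector modulo the maximal abelian subalgebra `M`, then `M` and `v`
span `L`. -/
lemma LieSubalgebra.sup_span_singleton_eq_top_of_isCoatom {M : LieSubalgebra F L}
    (hM : IsCoatom M) {v : L} (hv : v ∉ M) {χ : M → F}
    (hχ : ∀ m : M, ⁅(m : L), v⁆ - χ m • v ∈ M) :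
    M.toSubmodule ⊔ F ∙ v = ⊤ := by
  have hmv (m : L) (hm : m ∈ M) : ⁅m, v⁆ ∈ M.toSubmodule ⊔ F ∙ v := by
    rw [← sub_add_cancel ⁅m, v⁆ (χ ⟨m, hm⟩ • v)]
    exact Submodule.add_mem_sup (hχ ⟨m, hm⟩)
      (Submodule.smul_mem _ _ (Submodule.mem_span_singleton_self v))
  let K : LieSubalgebra F L :=
    { M.toSubmodule ⊔ F ∙ v with
      lie_mem' := by
        intro x y hx hy
        obtain ⟨a, ha, _, hc, rfl⟩ := Submodule.mem_sup.mp hx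
        obtain ⟨b, hb, _, hd, rfl⟩ := Submodule.mem_sup.mp hy
        obtain ⟨c, rfl⟩ := Submodule.mem_span_singleton.mp hc
        obtain ⟨d, rfl⟩ := Submodule.mem_span_singleton.mp hd
        have h : ⁅a + c • v, b + d • v⁆ = ⁅a, b⁆ + (d • ⁅a, v⁆ - c • ⁅b, v⁆) := by
          rw [← lie_skew b v]
          simp only [add_lie, lie_add, smul_lie, lie_smul, lie_self, smul_neg, smul_zero]
          module
        change ⁅a + c • v, b + d • v⁆ ∈ M.toSubmodule ⊔ F ∙ v
        rw [h]
        exact add_mem (Submodule.mem_sup_left (M.lie_mem ha hb))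
          (sub_mem (Submodule.smul_mem _ _ (hmv a ha)) (Submodule.smul_mem _ _ (hmv b hb))) }
  have hMK : M < K := by
    refine lt_of_le_of_ne (fun x hx ↦ (Submodule.mem_sup_left hx : x ∈ M.toSubmodule ⊔ F ∙ v)) ?_
    rintro h
    exact hv (h ▸ (Submodule.mem_sup_right (Submodule.mem_span_singleton_self v) :
      v ∈ M.toSubmodule ⊔ F ∙ v))
  exact congrArg LieSubalgebra.toSubmodule (hM.2 K hMK)

lemma LieSubalgebra.lie_eq_zero_of_isLieAbelian (M : LieSubalgebra F L) [IsLieAbelian M] {x y : L}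
    (hx : x ∈ M) (hy : y ∈ M) : ⁅x, y⁆ = 0 :=
  congrArg Subtype.val (LieModule.IsTrivial.trivial (⟨x, hx⟩ : M) (⟨y, hy⟩ : M))

/-- If `L` is spanned by an abelian subalgebra `M` and a vector `v ∉ M` on which `M` acts through
a nonzero character `χ`, then `ker χ` and `v` span an abelian ideal of codimension one. -/
lemma LieSubalgebra.exists_isLieAbelian_of_lie_eq_smul [FiniteDimensional F L]
    (M : LieSubalgebra F L) [IsLieAbelian M] {v : L} (hv : v ∉ M) (htop : M.toSubmodule ⊔ F ∙ v = ⊤)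
    {χ : Dual F M} (hχ : χ ≠ 0) (hχv : ∀ m : M, ⁅(m : L), v⁆ = χ m • v) :
    ∃ A : LieIdeal F L, IsLieAbelian A ∧ finrank F A + 1 = finrank F L := by
  have hlie (a b : M) (c d : F) :
      ⁅(a : L) + c • v, (b : L) + d • v⁆ = (d * χ a - c * χ b) • v := by
    have hab := M.lie_eq_zero_of_isLieAbelian a.2 b.2
    simp only [add_lie, lie_add, smul_lie, lie_smul, lie_self, smul_zero, hab,
      ← lie_skew v (b : L), hχv, smul_neg]
    module
  have hL (x : L) : ∃ (a : M) (c : F), (a : L) + c • v = x := by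
    obtain ⟨a, ha, _, hc, rfl⟩ := Submodule.mem_sup.mp (htop ▸ Submodule.mem_top : x ∈ _)
    obtain ⟨c, rfl⟩ := Submodule.mem_span_singleton.mp hc
    exact ⟨⟨a, ha⟩, c, rfl⟩
  let P : Submodule F L := χ.ker.map M.toSubmodule.subtype ⊔ F ∙ v
  have hP {x : L} (hx : x ∈ P) : ∃ (a : M) (c : F), χ a = 0 ∧ (a : L) + c • v = x := by
    obtain ⟨_, ⟨a, ha, rfl⟩, _, hc, rfl⟩ := Submodule.mem_sup.mp hx
    obtain ⟨c, rfl⟩ := Submodule.mem_span_singleton.mp hc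
    exact ⟨a, c, ha, rfl⟩
  let A : LieIdeal F L :=
    { P with
      lie_mem := by
        intro x y hy
        obtain ⟨a, c, rfl⟩ := hL x
        obtain ⟨b, d, -, rfl⟩ := hP hy
        rw [hlie]
        exact Submodule.mem_sup_right
          (Submodule.smul_mem _ _ (Submodule.mem_span_singleton_self v)) }
  refine ⟨A, ⟨fun x y ↦ Subtype.ext ?_⟩, ?_⟩
  · obtain ⟨a, c, ha, hx⟩ := hP x.2
    obtain ⟨b, d, hb, hy⟩ := hP y.2
    change ⁅(x : L), (y : L)⁆ = 0
    rw [← hx, ← hy, hlie, ha, hb]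
    simp
  · have hvP : v ∉ χ.ker.map M.toSubmodule.subtype := by
      rintro ⟨a, -, rfl⟩
      exact hv a.2
    have hA : finrank F A = finrank F χ.ker + 1 := by
      change finrank F P = _
      rw [Submodule.finrank_sup_span_singleton hvP]
      exact congrArg (· + 1) (Submodule.finrank_map_subtype_eq M.toSubmodule χ.ker)
    have hker := Module.Dual.finrank_ker_add_one_of_ne_zero hχ
    have hM := Submodule.finrank_sup_span_singleton (p := M.toSubmodule) hv
    rw [htop, finrank_top] at hM
    change finrank F χ.ker + 1 = finrank F M.toSubmodule at hker
    omega

/-- A Lie algebra over an algebraically closed field with an abelian maximal subalgebra has an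
abelian ideal of codimension one. -/
lemma LieSubalgebra.exists_isLieAbelian_of_isCoatom [IsAlgClosed F] [FiniteDimensional F L]
    {M : LieSubalgebra F L} (hM : IsCoatom M) (hab : IsLieAbelian M) :
    ∃ A : LieIdeal F L, IsLieAbelian A ∧ finrank F A + 1 = finrank F L := by
  obtain ⟨χ, w, hwM, hw⟩ := M.exists_lie_sub_smul_mem_of_isLieAbelian hM.1
  have htop := sup_span_singleton_eq_top_of_isCoatom hM hwM hw
  by_cases hχ : χ = 0
  · let A : LieIdeal F L :=
      { M.toSubmodule with
        lie_mem := by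
          intro x y hy
          obtain ⟨a, ha, _, hc, rfl⟩ := Submodule.mem_sup.mp (htop ▸ Submodule.mem_top : x ∈ _)
          obtain ⟨c, rfl⟩ := Submodule.mem_span_singleton.mp hc
          have hyw : ⁅y, w⁆ ∈ M := by simpa [hχ] using hw ⟨y, hy⟩
          change ⁅a + c • w, y⁆ ∈ M
          rw [add_lie, smul_lie, ← lie_skew w y]
          exact add_mem (M.lie_mem ha hy) (M.smul_mem _ (neg_mem hyw)) }
    refine ⟨A, ⟨fun x y ↦ Subtype.ext (M.lie_eq_zero_of_isLieAbelian x.2 y.2)⟩, ?_⟩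
    have h := Submodule.finrank_sup_span_singleton (p := M.toSubmodule) hwM
    rw [htop, finrank_top] at h
    exact h.symm
  · obtain ⟨m, hm⟩ : ∃ m, χ m ≠ 0 := by
      contrapose! hχ
      exact LinearMap.ext hχ
    have hv : ⁅(m : L), w⁆ ∉ M := fun h ↦ hwM <| by
      have := sub_mem h (hw m)
      rw [sub_sub_cancel] at this
      exact (M.toSubmodule.smul_mem_iff hm).mp this
    have hχv (x : M) : ⁅(x : L), ⁅(m : L), w⁆⁆ = χ x • ⁅(m : L), w⁆ := by
      have h := M.lie_eq_zero_of_isLieAbelian m.2 (hw x)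
      rw [lie_sub, lie_smul, sub_eq_zero] at h
      rw [leibniz_lie, M.lie_eq_zero_of_isLieAbelian x.2 m.2, zero_lie, zero_add, h]
    refine M.exists_isLieAbelian_of_lie_eq_smul hv ?_ hχ hχv
    exact sup_span_singleton_eq_top_of_isCoatom hM hv (χ := χ) fun x ↦ by simp [hχv]

lemma LieSubalgebra.isCoatom_of_finrank_add_one [FiniteDimensional F L] {M : LieSubalgebra F L}
    (hM : finrank F M + 1 = finrank F L) : IsCoatom M := by
  refine ⟨?_, fun K hK ↦ ?_⟩
  · rintro rfl
    have : finrank F (⊤ : LieSubalgebra F L) = finrank F L := finrank_top F L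
    omega
  · have hlt : finrank F M < finrank F K := Submodule.finrank_lt_finrank_of_lt (s := M.toSubmodule)
      (t := K.toSubmodule) hK
    have hle : finrank F K ≤ finrank F L := K.toSubmodule.finrank_le
    apply LieSubalgebra.toSubmodule_injective
    rw [LieSubalgebra.top_toSubmodule]
    exact Submodule.eq_top_of_finrank_eq (by change finrank F K = _; omega)

lemma LieSubalgebra.finrank_lt_of_isLieAbelian [FiniteDimensional F L] (hL : ¬ IsLieAbelian L)
    (M : LieSubalgebra F L) [IsLieAbelian M] : finrank F M < finrank F L := by
  refine Submodule.finrank_lt (s := M.toSubmodule) fun h ↦ hL ⟨fun x y ↦ ?_⟩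
  exact M.lie_eq_zero_of_isLieAbelian (h ▸ Submodule.mem_top : x ∈ M.toSubmodule)
    (h ▸ Submodule.mem_top : y ∈ M.toSubmodule)

end AbelianSubalgebra

/-- Let `L` be a non-abelian Lie algebra of dimension `n` over an
algebraically closed field `F`. Then `L` has an abelian maximal subalgebra if and only if
`L` has an abelian ideal of codimension one; in this case `α(L) = β(L) = n − 1`. -/
theorem maximal_abelian_subalgebra_iff (F L : Type*) [Field F] [IsAlgClosed F]
    [LieRing L] [LieAlgebra F L] [FiniteDimensional F L]
    (hnonab : ¬ IsLieAbelian L) (n : ℕ) (hn : Module.finrank F L = n) :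
    ((∃ M : LieSubalgebra F L, IsCoatom M ∧ IsLieAbelian M) ↔
      (∃ A : LieIdeal F L, IsLieAbelian A ∧ Module.finrank F A + 1 = n)) ∧
    ((∃ M : LieSubalgebra F L, IsCoatom M ∧ IsLieAbelian M) →
      alphaInv F L = n - 1 ∧ betaInv F L = n - 1) := by
  have hiff : (∃ M : LieSubalgebra F L, IsCoatom M ∧ IsLieAbelian M) ↔
      (∃ A : LieIdeal F L, IsLieAbelian A ∧ Module.finrank F A + 1 = n) := by
    subst hn
    refine ⟨fun ⟨M, hM, hab⟩ ↦ LieSubalgebra.exists_isLieAbelian_of_isCoatom hM hab, ?_⟩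
    rintro ⟨A, hab, hA⟩
    exact ⟨A.toLieSubalgebra, LieSubalgebra.isCoatom_of_finrank_add_one hA, hab⟩
  refine ⟨hiff, fun h ↦ ?_⟩
  obtain ⟨A, hab, hA⟩ := hiff.mp h
  have hlt (M : LieSubalgebra F L) (hM : IsLieAbelian M) : finrank F M ≤ n - 1 :=
    Nat.le_sub_one_of_lt (hn ▸ M.finrank_lt_of_isLieAbelian hnonab)
  have hA' : finrank F A = n - 1 := by omega
  constructor
  · refine IsGreatest.csSup_eq ⟨⟨A.toLieSubalgebra, hab, hA'⟩, ?_⟩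
    rintro _ ⟨M, hM, rfl⟩
    exact hlt M hM
  · refine IsGreatest.csSup_eq ⟨⟨A, hab, hA'⟩, ?_⟩
    rintro _ ⟨I, hI, rfl⟩
    exact hlt I.toLieSubalgebra hI
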